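/- arXiv:1410.7351 — 4 statements merged into one kernel-verified Lean document; each statement's English description precedes it below -/
import Mathlib

section
/- Let N and k be positive integers with 2k ≤ N and let M be an integer with M ≥ 8k − 4. Then there exists a set of measurement vectors φ_1, …, φ_M ∈ ℂ^N such that every k-sparse vector x ∈ ℂ^N can be recovered up to a unimodular factor from the intensity measurements b_m = |⟨x, φ_m⟩|², m = 1, …, M; that is, for all k-sparse x, z ∈ ℂ^N, if |⟨x, φ_m⟩| = |⟨z, φ_m⟩| for all m = 1, …, M, then there exists c ∈ ℂ with |c| = 1 such that z = c·x. -/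
/-- The inner product on `ℂ^N`: `⟨x, y⟩ = ∑ n, x[n] · conj(y[n])`. -/
noncomputable def cinner {N : ℕ} (x y : Fin N → ℂ) : ℂ :=
  ∑ n, x n * (starRingEnd ℂ) (y n)

/-- A vector `x ∈ ℂ^N` is `k`-sparse if it has at most `k` nonzero entries. -/
def IsSparse {N : ℕ} (k : ℕ) (x : Fin N → ℂ) : Prop :=
  (Finset.univ.filter fun n => x n ≠ 0).card ≤ k

open Cardinal in
theorem exists_algebraicIndependent_rat_real (ι : Type) [Finite ι] :
    ∃ a : ι → ℝ, AlgebraicIndependent ℚ a := by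
  obtain ⟨s, hs⟩ := exists_isTranscendenceBasis ℚ ℝ
  have hinf : Infinite s := by
    by_contra hfin
    rw [not_infinite_iff_finite] at hfin
    have halg := hs.isAlgebraic
    have hcard : #(Algebra.adjoin ℚ (Set.range ((↑) : s → ℝ))) ≤ ℵ₀ := by
      rw [← Cardinal.mk_congr hs.1.aevalEquiv.toEquiv]
      exact MvPolynomial.cardinalMk_le_max.trans (by simp)
    have hle := Algebra.IsAlgebraic.cardinalMk_le_max
      (Algebra.adjoin ℚ (Set.range ((↑) : s → ℝ))) ℝ
    rw [max_eq_right hcard, Cardinal.mk_real] at hle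
    exact absurd hle (not_le.mpr Cardinal.aleph0_lt_continuum)
  obtain ⟨f⟩ : Nonempty (ι ↪ s) := by
    cases nonempty_fintype ι
    exact ⟨(Fintype.equivFin ι).toEmbedding.trans
      (Fin.valEmbedding.trans (Infinite.natEmbedding s))⟩
  exact ⟨fun i => f i, hs.1.comp f f.injective⟩

/-- Exchange property of algebraic independence: after adjoining finitely many elements `P`,
all but at most `#P` members of an algebraically independent family remain independent. -/
theorem AlgebraicIndependent.exists_algebraicIndepOn_of_finset {ι F L : Type*} [Finite ι]
    [Field F] [Field L] [Algebra F L] {a : ι → L} (ha : AlgebraicIndependent F a)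
    (P : Finset L) :
    ∃ (J : Set ι) (S : Subalgebra F L), J.ncard ≤ P.card ∧ (P : Set L) ⊆ S ∧
      AlgebraicIndepOn S a Jᶜ := by
  obtain ⟨B, hB⟩ := (AlgebraicIndependent.matroid F L).exists_isBasis (P : Set L) (by simp)
  obtain ⟨D, hD, hBD⟩ := hB.indep.subset_isBasis_of_subset
    (Set.subset_union_left (t := Set.range a)) (by simp)
  have hDindep : AlgebraicIndepOn F id D := AlgebraicIndependent.matroid_indep_iff.mp hD.indep
  have hrange : (AlgebraicIndependent.matroid F L).Indep (Set.range a) :=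
    AlgebraicIndependent.matroid_indep_iff.mpr ha.to_subtype_range
  have hcard : (Set.range a).encard ≤ D.encard := by
    rw [hD.encard_eq_eRk]
    exact hrange.encard_le_eRk_of_subset Set.subset_union_right
  refine ⟨(a ⁻¹' (D \ B))ᶜ,
    (Subalgebra.algebraicClosure (Algebra.adjoin F B) L).restrictScalars F, ?_, ?_, ?_⟩
  · have hBfin : B.Finite := P.finite_toSet.subset hB.subset
    have hDfin : D.Finite :=
      (hBfin.union (Set.finite_range a)).subset hD.subset
    have hBP : B.ncard ≤ P.card := by
      simpa using Set.ncard_le_ncard hB.subset P.finite_toSet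
    have hpre : (a ⁻¹' (D \ B)).ncard = (D \ B).ncard := by
      refine Set.ncard_preimage_of_injective_subset_range ha.injective ?_
      rintro d ⟨hd, hdB⟩
      exact (hD.subset hd).resolve_left hdB
    have h1 := Set.ncard_add_ncard_compl (a ⁻¹' (D \ B))
    have h2 := Set.ncard_sdiff_add_ncard_of_subset hBD hDfin
    have h3 : Nat.card ι ≤ D.ncard := by
      rw [← Set.ncard_range_of_injective ha.injective]
      exact ENat.toNat_le_toNat hcard (by simpa using hDfin)
    omega
  · intro p hp
    exact (AlgebraicIndependent.matroid_isBasis_iff.mp hB).2.2 p hp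
  · have h1 : AlgebraicIndependent (Algebra.adjoin F B) (fun i : (D \ B : Set L) => (i : L)) := by
      have h0 := hDindep.adjoin_of_disjoint (s := {d : D | (d : L) ∈ B})
        (disjoint_compl_right (a := {d : D | (d : L) ∈ B}))
      have himage : (fun d : D => id (d : L)) '' {d : D | (d : L) ∈ B} = B := by
        ext l
        simpa using fun hl => hBD hl
      rw [himage] at h0
      exact h0.comp (fun i : (D \ B : Set L) => ⟨⟨i, i.2.1⟩, i.2.2⟩)
        fun i j hij => Subtype.ext congr(($hij).1.1)
    have h2 := h1.subalgebraAlgebraicClosure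
    rw [compl_compl]
    exact h2.comp (fun i : a ⁻¹' (D \ B) => ⟨a i, i.2⟩)
      (fun i j h => Subtype.ext (ha.injective congr(($h).1)))

theorem eq_smul_of_norm_cinner_eq {N : ℕ} {x z : Fin N → ℂ}
    (h : ∀ φ, ‖cinner x φ‖ = ‖cinner z φ‖) : ∃ c : ℂ, ‖c‖ = 1 ∧ z = c • x := by
  have key : ∀ u v : Fin N → ℂ, cinner u v = inner ℂ (WithLp.toLp 2 v) (WithLp.toLp 2 u) := by
    intro u v
    simp [cinner, PiLp.inner_apply]
  have hx := h x
  have hz := h z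
  simp only [key, inner_self_eq_norm_sq_to_K] at hx hz
  simp only [norm_pow, Complex.coe_algebraMap, Complex.norm_real, norm_norm] at hx hz
  rw [norm_inner_symm] at hz
  have hnorm : ‖WithLp.toLp 2 x‖ = ‖WithLp.toLp 2 z‖ :=
    (sq_eq_sq₀ (norm_nonneg _) (norm_nonneg _)).mp (hx.trans hz)
  by_cases hx0 : x = 0
  · subst hx0
    have hz0 : z = 0 := by simpa using hnorm.symm
    exact ⟨1, by simp, by simp [hz0]⟩
  have hX : WithLp.toLp 2 x ≠ 0 := by simpa using hx0
  have hZ : WithLp.toLp 2 z ≠ 0 := norm_pos_iff.mp (hnorm ▸ norm_pos_iff.mpr hX)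
  obtain ⟨c, -, hc⟩ := (norm_inner_eq_norm_iff (𝕜 := ℂ) hX hZ).mp
    (by rw [← hx, ← hnorm, sq])
  refine ⟨c, ?_, by simpa using congrArg WithLp.ofLp hc⟩
  rw [hc, norm_smul] at hnorm
  exact (mul_eq_right₀ (norm_ne_zero_iff.mpr hX)).mp hnorm.symm

open MvPolynomial in
theorem norm_cinner_eq_of_algebraicIndependent {N : ℕ} {S : Subalgebra ℚ ℝ} {x z : Fin N → ℂ}
    (hx : ∀ n, (x n).re ∈ S ∧ (x n).im ∈ S) (hz : ∀ n, (z n).re ∈ S ∧ (z n).im ∈ S)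
    {b : Fin N ⊕ Fin N → ℝ} (hb : AlgebraicIndependent S b)
    (h : ‖cinner x fun n => ⟨b (.inl n), b (.inr n)⟩‖ =
      ‖cinner z fun n => ⟨b (.inl n), b (.inr n)⟩‖) (φ : Fin N → ℂ) :
    ‖cinner x φ‖ = ‖cinner z φ‖ := by
  let Q (r i : Fin N → S) : MvPolynomial (Fin N ⊕ Fin N) S :=
    (∑ n, (C (r n) * X (.inl n) + C (i n) * X (.inr n))) ^ 2 +
    (∑ n, (-(C (r n) * X (.inr n)) + C (i n) * X (.inl n))) ^ 2
  have hQ (y : Fin N → ℂ) (hy : ∀ n, (y n).re ∈ S ∧ (y n).im ∈ S) (d : Fin N ⊕ Fin N → ℝ) :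
      aeval d (Q (fun n => ⟨_, (hy n).1⟩) (fun n => ⟨_, (hy n).2⟩)) =
        ‖cinner y fun n => ⟨d (.inl n), d (.inr n)⟩‖ ^ 2 := by
    rw [← Complex.normSq_eq_norm_sq, Complex.normSq_apply]
    simp [Q, cinner, Complex.mul_re, Complex.mul_im, Algebra.algebraMap_eq_smul_one,
      Subalgebra.smul_def, pow_two]
  have hzero := hb.eq_zero_of_aeval_eq_zero
    (Q (fun n => ⟨_, (hx n).1⟩) (fun n => ⟨_, (hx n).2⟩) -
      Q (fun n => ⟨_, (hz n).1⟩) (fun n => ⟨_, (hz n).2⟩))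
    (by rw [map_sub, hQ x hx, hQ z hz, h, sub_self])
  have hφ := hQ x hx (Sum.elim (fun n => (φ n).re) (fun n => (φ n).im))
  rw [sub_eq_zero.mp hzero, hQ z hz] at hφ
  exact (sq_eq_sq₀ (norm_nonneg _) (norm_nonneg _)).mp hφ.symm

theorem eq_smul_of_sparse_of_norm_cinner_eq {N k M : ℕ} (hk : 0 < k) (hM : M ≥ 8 * k - 4)
    {a : Fin M × (Fin N ⊕ Fin N) → ℝ} (ha : AlgebraicIndependent ℚ a)
    {x z : Fin N → ℂ} (hx : IsSparse k x) (hz : IsSparse k z) {n₀ : Fin N} (hn₀ : x n₀ = 1)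
    (h : ∀ m, ‖cinner x fun n => ⟨a (m, .inl n), a (m, .inr n)⟩‖ =
      ‖cinner z fun n => ⟨a (m, .inl n), a (m, .inr n)⟩‖) :
    ∃ c : ℂ, ‖c‖ = 1 ∧ z = c • x := by
  classical
  let P (y : Fin N → ℂ) : Finset ℝ :=
    (Finset.univ.filter fun n => y n ≠ 0).image (fun n => (y n).re) ∪
    (Finset.univ.filter fun n => y n ≠ 0).image (fun n => (y n).im)
  have hPcard {y : Fin N → ℂ} (hy : IsSparse k y) : (P y).card ≤ 2 * k := by
    refine (Finset.card_union_le _ _).trans ?_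
    have := Finset.card_image_le (s := Finset.univ.filter fun n => y n ≠ 0) (f := fun n => (y n).re)
    have := Finset.card_image_le (s := Finset.univ.filter fun n => y n ≠ 0) (f := fun n => (y n).im)
    unfold IsSparse at hy
    omega
  have hone : (1 : ℝ) ∈ P x ∪ P z := by
    refine Finset.mem_union_left _ (Finset.mem_union_left _ (Finset.mem_image.mpr ⟨n₀, ?_, ?_⟩)) <;>
    simp [hn₀]
  obtain ⟨J, S, hJ, hPS, hS⟩ := ha.exists_algebraicIndepOn_of_finset ((P x ∪ P z).erase 1)
  have hJM : J.ncard < M := by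
    have h1 := Finset.card_erase_add_one hone
    have h2 := Finset.card_union_le (P x) (P z)
    have := hPcard hx
    have := hPcard hz
    omega
  have hmem {t : ℝ} (ht : t ∈ P x ∪ P z) : t ∈ S := by
    by_cases h1 : t = 1
    · exact h1 ▸ one_mem S
    · exact hPS (by simpa [h1] using ht)
  have hre {y : Fin N → ℂ} (hy : P y ⊆ P x ∪ P z) (n : Fin N) :
      (y n).re ∈ S ∧ (y n).im ∈ S := by
    by_cases h0 : y n = 0
    · simp [h0]
    · constructor <;> apply hmem <;> apply hy
      · exact Finset.mem_union_left _ (Finset.mem_image_of_mem _ (by simp [h0]))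
      · exact Finset.mem_union_right _ (Finset.mem_image_of_mem (fun n => (y n).im) (by simp [h0]))
  obtain ⟨m, hm⟩ : ∃ m : Fin M, ∀ j, (m, j) ∉ J := by
    by_contra! hcon
    have hsurj : Prod.fst '' J = Set.univ := by
      ext m
      obtain ⟨j, hj⟩ := hcon m
      exact ⟨fun _ => trivial, fun _ => ⟨_, hj, rfl⟩⟩
    have := Set.ncard_image_le (f := Prod.fst) (Set.toFinite J)
    rw [hsurj, Set.ncard_univ, Nat.card_fin] at this
    omega
  refine eq_smul_of_norm_cinner_eq (norm_cinner_eq_of_algebraicIndependent (S := S)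
    (b := fun j => a (m, j)) (hre Finset.subset_union_left) (hre Finset.subset_union_right)
    (hS.comp (fun j => ⟨(m, j), hm j⟩) fun i j hij => by simpa using hij) (h m))

theorem cinner_smul_left {N : ℕ} (c : ℂ) (x y : Fin N → ℂ) :
    cinner (c • x) y = c * cinner x y := by
  simp [cinner, Finset.mul_sum, mul_assoc]

theorem IsSparse.smul {N k : ℕ} {x : Fin N → ℂ} (hx : IsSparse k x) (c : ℂ) :
    IsSparse k (c • x) :=
  (Finset.card_le_card (Finset.monotone_filter_right _ fun n _ => by
    simp)).trans hx

/-- If `M ≥ 8k - 4` then there exists a set of `M` measurement vectors in `ℂ^N` such that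
every `k`-sparse vector can be recovered, up to a unimodular factor, from the intensity
measurements `|⟨x, φ_m⟩|²`. -/
theorem exists_injective_sparse_phase_retrieval_measurements
    (N k M : ℕ) (hN : 0 < N) (hk : 0 < k) (hkN : 2 * k ≤ N) (hM : M ≥ 8 * k - 4) :
    ∃ φ : Fin M → (Fin N → ℂ),
      ∀ x z : Fin N → ℂ, IsSparse k x → IsSparse k z →
        (∀ m : Fin M, ‖cinner x (φ m)‖ = ‖cinner z (φ m)‖) →
        ∃ c : ℂ, ‖c‖ = 1 ∧ z = c • x := by
  obtain ⟨a, ha⟩ := exists_algebraicIndependent_rat_real (Fin M × (Fin N ⊕ Fin N))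
  let φ (m : Fin M) (n : Fin N) : ℂ := ⟨a (m, .inl n), a (m, .inr n)⟩
  have main : ∀ x z : Fin N → ℂ, x ≠ 0 → IsSparse k x → IsSparse k z →
      (∀ m : Fin M, ‖cinner x (φ m)‖ = ‖cinner z (φ m)‖) → ∃ c : ℂ, ‖c‖ = 1 ∧ z = c • x := by
    intro x z hx0 hx hz h
    obtain ⟨n₀, hn₀⟩ := Function.ne_iff.mp hx0
    obtain ⟨c, hc, hcz⟩ := eq_smul_of_sparse_of_norm_cinner_eq hk hM ha
      (hx.smul (x n₀)⁻¹) (hz.smul (x n₀)⁻¹) (n₀ := n₀) (by simpa using inv_mul_cancel₀ hn₀)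
      (fun m => by rw [cinner_smul_left, cinner_smul_left, norm_mul, norm_mul]; congr 1; exact h m)
    refine ⟨c, hc, ?_⟩
    rw [smul_comm] at hcz
    exact smul_right_injective _ (inv_ne_zero hn₀) hcz
  refine ⟨φ, fun x z hx hz h => ?_⟩
  by_cases hx0 : x = 0
  · by_cases hz0 : z = 0
    · exact ⟨1, by simp, by simp [hx0, hz0]⟩
    · obtain ⟨c, hc, hcz⟩ := main z x hz0 hz hx fun m => (h m).symm
      have hc0 : c ≠ 0 := norm_pos_iff.mp (hc ▸ one_pos)
      exact absurd ((smul_eq_zero.mp (hcz.symm.trans hx0)).resolve_left hc0) hz0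
  · exact main x z hx0 hx hz h
end

section
/- Let A ∈ ℂ^{L×N} be a matrix that is injective on k-sparse vectors (i.e., if x and z are k-sparse and Ax = Az then x = z), and let ψ_1, …, ψ_M ∈ ℂ^L be vectors whose intensity measurement map is injective up to a unimodular factor on ℂ^L (i.e., for all y, w ∈ ℂ^L, if |⟨y, ψ_m⟩| = |⟨w, ψ_m⟩| for all m, then w = c·y for some c ∈ ℂ with |c| = 1). Define φ_m := A*ψ_m ∈ ℂ^N for m = 1, …, M, where A* is the conjugate transpose of A. Then for all k-sparse x, z ∈ ℂ^N, if |⟨x, φ_m⟩| = |⟨z, φ_m⟩| for all m = 1, …, M, then there exists c ∈ ℂ with |c| = 1 such that z = c·x. -/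
/-- The conjugate transpose is the adjoint with respect to `cinner`. -/
theorem cinner_conjTranspose_mulVec {L N : ℕ} (A : Matrix (Fin L) (Fin N) ℂ)
    (x : Fin N → ℂ) (y : Fin L → ℂ) :
    cinner x (A.conjTranspose.mulVec y) = cinner (A.mulVec x) y := by
  simp only [cinner, Matrix.mulVec, dotProduct, Matrix.conjTranspose_apply, map_sum, map_mul,
    Finset.mul_sum, Finset.sum_mul, starRingEnd_apply, star_star]
  rw [Finset.sum_comm]
  exact Finset.sum_congr rfl fun _ _ => Finset.sum_congr rfl fun _ _ => by ring

/-- If `A ∈ ℂ^{L×N}` is injective on `k`-sparse vectors and the intensity measurement map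
of `ψ_1, …, ψ_M ∈ ℂ^L` is injective up to a unimodular factor on `ℂ^L`, then the measurement
vectors `φ_m := A* ψ_m` allow recovery of every `k`-sparse vector up to a unimodular factor
from the intensity measurements `|⟨x, φ_m⟩|²`. -/
theorem sparse_phase_retrieval_of_compose
    (L N M k : ℕ) (A : Matrix (Fin L) (Fin N) ℂ)
    (hA : ∀ x z : Fin N → ℂ, IsSparse k x → IsSparse k z →
      A.mulVec x = A.mulVec z → x = z)
    (ψ : Fin M → (Fin L → ℂ))
    (hψ : ∀ y w : Fin L → ℂ,
      (∀ m : Fin M, ‖cinner y (ψ m)‖ = ‖cinner w (ψ m)‖) →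
      ∃ c : ℂ, ‖c‖ = 1 ∧ w = c • y)
    (φ : Fin M → (Fin N → ℂ)) (hφ : ∀ m, φ m = A.conjTranspose.mulVec (ψ m))
    (x z : Fin N → ℂ) (hx : IsSparse k x) (hz : IsSparse k z)
    (h : ∀ m : Fin M, ‖cinner x (φ m)‖ = ‖cinner z (φ m)‖) :
    ∃ c : ℂ, ‖c‖ = 1 ∧ z = c • x := by
  obtain ⟨c, hc, hzx⟩ := hψ (A.mulVec x) (A.mulVec z) fun m => by
    simpa only [hφ, cinner_conjTranspose_mulVec] using h m
  exact ⟨c, hc, hA z (c • x) hz (hx.smul c) (by rw [hzx, Matrix.mulVec_smul])⟩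
end

section
/- Let α = √((1 − 1/√3)/2) and β = e^{−i5π/4}·√((1 + 1/√3)/2). For any a, b ∈ ℂ define the four intensities I_1(a,b) = |α·a + conj(β)·b|², I_2(a,b) = |conj(β)·a + α·b|², I_3(a,b) = |α·a − conj(β)·b|², I_4(a,b) = |−conj(β)·a + α·b|². If a, b, a′, b′ ∈ ℂ satisfy I_s(a′,b′) = I_s(a,b) for s = 1, 2, 3, 4, then |a′| = |a|, |b′| = |b|, and a′·conj(b′) = a·conj(b). -/
/-- The constant `α = √((1 − 1/√3)/2)`. -/
noncomputable def alphaPR : ℝ := Real.sqrt ((1 - 1 / Real.sqrt 3) / 2)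

/-- The constant `β = e^{−i5π/4} · √((1 + 1/√3)/2)`. -/
noncomputable def betaPR : ℂ :=
  Complex.exp (-(Complex.I * (5 * Real.pi / 4))) *
    (Real.sqrt ((1 + 1 / Real.sqrt 3) / 2) : ℝ)

/-- The four intensities `I_1, …, I_4` associated with a pair `(a, b) ∈ ℂ²`. -/
noncomputable def intensity (s : Fin 4) (a b : ℂ) : ℝ :=
  norm
    (![(alphaPR : ℂ) * a + (starRingEnd ℂ) betaPR * b,
       (starRingEnd ℂ) betaPR * a + (alphaPR : ℂ) * b,
       (alphaPR : ℂ) * a - (starRingEnd ℂ) betaPR * b,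
       -(starRingEnd ℂ) betaPR * a + (alphaPR : ℂ) * b] s) ^ 2

theorem alphaPR_sq : alphaPR ^ 2 = (1 - 1 / Real.sqrt 3) / 2 := by
  have h : 1 / Real.sqrt 3 ≤ 1 := by
    rw [div_le_one (by positivity)]
    exact Real.one_le_sqrt.2 (by norm_num)
  exact Real.sq_sqrt (by linarith)

theorem alphaPR_pos : 0 < alphaPR := by
  have h : 1 / Real.sqrt 3 < 1 := by
    rw [div_lt_one (by positivity)]
    exact Real.lt_sqrt_of_sq_lt (by norm_num)
  exact Real.sqrt_pos.2 (by linarith)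

theorem exp_neg_I_mul_five_pi_div_four :
    Complex.exp (-(Complex.I * (5 * Real.pi / 4))) =
      ⟨-(Real.sqrt 2 / 2), Real.sqrt 2 / 2⟩ := by
  have h : -(Complex.I * (5 * Real.pi / 4)) =
      ((-(Real.pi / 4 + Real.pi) : ℝ) : ℂ) * Complex.I := by
    push_cast
    ring
  rw [h]
  apply Complex.ext
  · rw [Complex.exp_ofReal_mul_I_re, Real.cos_neg, Real.cos_add_pi, Real.cos_pi_div_four]
  · rw [Complex.exp_ofReal_mul_I_im, Real.sin_neg, Real.sin_add_pi, Real.sin_pi_div_four, neg_neg]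

theorem betaPR_im_eq_neg_re : betaPR.im = -betaPR.re := by
  rw [betaPR, exp_neg_I_mul_five_pi_div_four, Complex.im_mul_ofReal, Complex.re_mul_ofReal]
  ring

theorem two_mul_betaPR_re_sq : 2 * betaPR.re ^ 2 = (1 + 1 / Real.sqrt 3) / 2 := by
  rw [betaPR, exp_neg_I_mul_five_pi_div_four, Complex.re_mul_ofReal, mul_pow,
    Real.sq_sqrt (by positivity), neg_sq, div_pow, Real.sq_sqrt (by norm_num)]
  ring

theorem betaPR_re_ne_zero : betaPR.re ≠ 0 := by
  intro h
  have h2 := two_mul_betaPR_re_sq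
  rw [h] at h2
  have : 0 < 1 / Real.sqrt 3 := by positivity
  linarith

theorem alphaPR_sq_ne_two_mul_betaPR_re_sq : alphaPR ^ 2 - 2 * betaPR.re ^ 2 ≠ 0 := by
  rw [alphaPR_sq, two_mul_betaPR_re_sq]
  have : 0 < 1 / Real.sqrt 3 := by positivity
  intro h
  linarith

theorem alphaPR_sq_add_two_mul_betaPR_re_sq : alphaPR ^ 2 + 2 * betaPR.re ^ 2 = 1 := by
  rw [alphaPR_sq, two_mul_betaPR_re_sq]
  ring

/-- If `(a', b')` produces the same four intensities as `(a, b)`, then `|a'| = |a|`,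
`|b'| = |b|`, and `a'·conj(b') = a·conj(b)`. -/
theorem intensities_determine_moduli_and_product
    (a b a' b' : ℂ) (h : ∀ s : Fin 4, intensity s a' b' = intensity s a b) :
    ‖a'‖ = ‖a‖ ∧ ‖b'‖ = ‖b‖ ∧
    a' * (starRingEnd ℂ) b' = a * (starRingEnd ℂ) b := by
  have h0 := h 0
  have h1 := h 1
  have h2 := h 2
  have h3 := h 3
  simp only [intensity, Matrix.cons_val, ← Complex.normSq_eq_norm_sq, Complex.normSq_apply,
    Complex.add_re, Complex.add_im, Complex.sub_re, Complex.sub_im, Complex.mul_re, Complex.mul_im,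
    Complex.neg_re, Complex.neg_im, Complex.conj_re, Complex.conj_im, Complex.ofReal_re,
    Complex.ofReal_im, betaPR_im_eq_neg_re] at h0 h1 h2 h3
  have hsum := alphaPR_sq_add_two_mul_betaPR_re_sq
  have hdiff := alphaPR_sq_ne_two_mul_betaPR_re_sq
  have hprod : alphaPR * betaPR.re ≠ 0 := mul_ne_zero alphaPR_pos.ne' betaPR_re_ne_zero
  generalize alphaPR = p at *
  generalize betaPR.re = t at *
  have add_normSq : Complex.normSq a' + Complex.normSq b' =
      Complex.normSq a + Complex.normSq b := by
    simp only [Complex.normSq_apply]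
    linear_combination (h0 + h1 + h2 + h3) / 2 - hsum *
      (a'.re * a'.re + a'.im * a'.im + (b'.re * b'.re + b'.im * b'.im)
        - (a.re * a.re + a.im * a.im + (b.re * b.re + b.im * b.im)))
  have sub_normSq : Complex.normSq a' - Complex.normSq b' =
      Complex.normSq a - Complex.normSq b := by
    apply mul_left_cancel₀ hdiff
    simp only [Complex.normSq_apply]
    linear_combination (h0 + h2 - h1 - h3) / 2
  have normSq_a : Complex.normSq a' = Complex.normSq a := by linarith
  have normSq_b : Complex.normSq b' = Complex.normSq b := by linarith
  refine ⟨?_, ?_, ?_⟩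
  · rwa [Complex.normSq_eq_norm_sq, Complex.normSq_eq_norm_sq,
      sq_eq_sq₀ (norm_nonneg _) (norm_nonneg _)] at normSq_a
  · rwa [Complex.normSq_eq_norm_sq, Complex.normSq_eq_norm_sq,
      sq_eq_sq₀ (norm_nonneg _) (norm_nonneg _)] at normSq_b
  · apply Complex.ext
    · apply mul_left_cancel₀ hprod
      simp only [Complex.mul_re, Complex.conj_re, Complex.conj_im]
      linear_combination (h0 - h2 + h1 - h3) / 8
    · apply mul_left_cancel₀ hprod
      simp only [Complex.mul_im, Complex.conj_re, Complex.conj_im]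
      linear_combination (h0 - h2 - h1 + h3) / 8
end

section
/- Let k ≥ 1 and let ℒ = {l_1, …, l_L} ⊆ {1, …, N} be a set of L ≥ 1 sampling points such that the partial DFT matrix F_ℒ ∈ ℂ^{L×N} (consisting of the rows of the unitary DFT matrix F indexed by ℒ) is injective on k-sparse vectors (i.e., if x and z are k-sparse and F_ℒ x = F_ℒ z then x = z). Consider the four masks p_s ∈ ℂ^N defined by p_s[n] = a_s·δ[n] + b_s, where δ[1] = 1, δ[n] = 0 for n ≠ 1, and (a_1,b_1) = (α, β), (a_2,b_2) = (β, α), (a_3,b_3) = (α, −β), (a_4,b_4) = (−β, α). Then for all k-sparse x, z ∈ ℂ^N with x[1] ≠ 0, if |(F(x ⊙ p_s))[l]|² = |(F(z ⊙ p_s))[l]|² for all s = 1,…,4 and all l ∈ ℒ, then there exists c ∈ ℂ with |c| = 1 such that z = c·x. -/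
/-- The coefficients `(a_1, …, a_4) = (α, β, α, −β)`. -/
noncomputable def coefA : Fin 4 → ℂ := ![(alphaPR : ℂ), betaPR, (alphaPR : ℂ), -betaPR]

/-- The coefficients `(b_1, …, b_4) = (β, α, −β, α)`. -/
noncomputable def coefB : Fin 4 → ℂ := ![betaPR, (alphaPR : ℂ), -betaPR, (alphaPR : ℂ)]

/-- The unitary DFT matrix `F ∈ ℂ^{N×N}` with entries
`[F]_{m,n} = (1/√N)·e^{−i2π(m−1)(n−1)/N}` (here indexed from `0`). -/
noncomputable def dftMatrix (N : ℕ) : Matrix (Fin N) (Fin N) ℂ :=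
  fun m n =>
    (1 / (Real.sqrt N : ℂ)) *
      Complex.exp (-(Complex.I * 2 * Real.pi * (m.val : ℂ) * (n.val : ℂ) / (N : ℂ)))

theorem exists_betaPR_eq :
    ∃ b : ℝ, b ≠ 0 ∧ alphaPR ^ 2 ≠ 2 * b ^ 2 ∧ betaPR = ⟨-b, b⟩ := by
  set r := Real.sqrt ((1 + 1 / Real.sqrt 3) / 2) with hr
  have h3 : 0 < 1 / Real.sqrt 3 := by positivity
  have h3' : 1 / Real.sqrt 3 ≤ 1 := by
    rw [div_le_one (by positivity)]
    exact Real.one_le_sqrt.2 (by norm_num)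
  have hrpos : 0 < r := Real.sqrt_pos.2 (by positivity)
  have hr2 : r ^ 2 = (1 + 1 / Real.sqrt 3) / 2 := Real.sq_sqrt (by positivity)
  have ha2 : alphaPR ^ 2 = (1 - 1 / Real.sqrt 3) / 2 := Real.sq_sqrt (by linarith)
  have h2 : Real.sqrt 2 ^ 2 = 2 := Real.sq_sqrt (by norm_num)
  refine ⟨Real.sqrt 2 / 2 * r, by positivity, ?_, ?_⟩
  · rw [mul_pow, div_pow, h2, hr2, ha2]
    intro h
    linarith
  · have hexp : Complex.exp (-(Complex.I * (5 * Real.pi / 4)))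
        = ⟨-(Real.sqrt 2 / 2), Real.sqrt 2 / 2⟩ := by
      have harg : -(Complex.I * (5 * Real.pi / 4))
          = ((-(Real.pi / 4 + Real.pi) : ℝ) : ℂ) * Complex.I := by
        push_cast
        ring
      rw [harg]
      apply Complex.ext
      · rw [Complex.exp_ofReal_mul_I_re, Real.cos_neg, Real.cos_add_pi, Real.cos_pi_div_four]
      · rw [Complex.exp_ofReal_mul_I_im, Real.sin_neg, Real.sin_add_pi, Real.sin_pi_div_four,
          neg_neg]
    rw [betaPR, hexp]
    apply Complex.ext <;> simp [hr]

theorem alphaPR_ne_zero : alphaPR ≠ 0 := by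
  have h3 : 1 / Real.sqrt 3 < 1 := by
    rw [div_lt_one (by positivity)]
    exact Real.lt_sqrt_of_sq_lt (by norm_num)
  exact (Real.sqrt_pos.2 (by linarith)).ne'

/-- The four intensities `‖a_s u + b_s v‖²` determine `‖u‖` and, up to a common phase,
the pair `(u, v)`. -/
theorem norm_eq_and_mul_eq_of_intensities {u v u' v' : ℂ} (hu : u ≠ 0)
    (h : ∀ s : Fin 4, ‖coefA s * u + coefB s * v‖ ^ 2 = ‖coefA s * u' + coefB s * v'‖ ^ 2) :
    ‖u‖ = ‖u'‖ ∧ u * v' = u' * v := by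
  obtain ⟨b, hb, hab, hβ⟩ := exists_betaPR_eq
  have ha := alphaPR_ne_zero
  have h1 := h 0
  have h2 := h 1
  have h3 := h 2
  have h4 := h 3
  simp [coefA, coefB, hβ, Complex.sq_norm, Complex.normSq_apply] at h1 h2 h3 h4
  generalize alphaPR = a at *
  have hsum₁ : a ^ 2 * (Complex.normSq u - Complex.normSq u')
      + 2 * b ^ 2 * (Complex.normSq v - Complex.normSq v') = 0 := by
    simp only [Complex.normSq_apply]
    linear_combination (h1 + h3) / 2
  have hsum₂ : 2 * b ^ 2 * (Complex.normSq u - Complex.normSq u')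
      + a ^ 2 * (Complex.normSq v - Complex.normSq v') = 0 := by
    simp only [Complex.normSq_apply]
    linear_combination (h2 + h4) / 2
  have hpos : a ^ 2 + 2 * b ^ 2 ≠ 0 := by positivity
  have hnorm : Complex.normSq u = Complex.normSq u' := by
    have : (a ^ 2 - 2 * b ^ 2) * (a ^ 2 + 2 * b ^ 2)
        * (Complex.normSq u - Complex.normSq u') = 0 := by
      linear_combination a ^ 2 * hsum₁ - 2 * b ^ 2 * hsum₂
    have := (mul_eq_zero.1 this).resolve_left (mul_ne_zero (sub_ne_zero.2 hab) hpos)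
    linarith
  have hre : u.re * v.re + u.im * v.im = u'.re * v'.re + u'.im * v'.im := by
    have : a * b * ((u.re * v.re + u.im * v.im) - (u'.re * v'.re + u'.im * v'.im)) = 0 := by
      linear_combination -(h1 - h3 + h2 - h4) / 8
    have := (mul_eq_zero.1 this).resolve_left (mul_ne_zero ha hb)
    linarith
  have him : u.re * v.im - u.im * v.re = u'.re * v'.im - u'.im * v'.re := by
    have : a * b * ((u.re * v.im - u.im * v.re) - (u'.re * v'.im - u'.im * v'.re)) = 0 := by
      linear_combination -(h1 - h3 - h2 + h4) / 8
    have := (mul_eq_zero.1 this).resolve_left (mul_ne_zero ha hb)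
    linarith
  refine ⟨?_, ?_⟩
  · rw [Complex.norm_def, Complex.norm_def, hnorm]
  · have hconj : (starRingEnd ℂ) u * v = (starRingEnd ℂ) u' * v' := by
      apply Complex.ext <;> simp <;> linarith
    have hnorm' : (starRingEnd ℂ) u * u = (starRingEnd ℂ) u' * u' := by
      rw [← Complex.normSq_eq_conj_mul_self, ← Complex.normSq_eq_conj_mul_self, hnorm]
    have hcu : (starRingEnd ℂ) u ≠ 0 := by simpa using hu
    apply mul_left_cancel₀ hcu
    linear_combination v' * hnorm' - u' * hconj

theorem dftMatrix_apply_zero_ne_zero {N : ℕ} (hN : 0 < N) (m : Fin N) :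
    dftMatrix N m ⟨0, hN⟩ ≠ 0 := by
  have : Real.sqrt N ≠ 0 := by positivity
  simp [dftMatrix, this]

theorem mulVec_mul_delta_add_const {N : ℕ} (hN : 0 < N) (A : Matrix (Fin N) (Fin N) ℂ)
    (x : Fin N → ℂ) (a b : ℂ) (m : Fin N) :
    A.mulVec (fun n => x n * (a * (if n.val = 0 then 1 else 0) + b)) m
      = a * (A m ⟨0, hN⟩ * x ⟨0, hN⟩) + b * A.mulVec x m := by
  have hδ : ∀ n : Fin N, n.val = 0 ↔ n = ⟨0, hN⟩ := fun n => by simp [Fin.ext_iff]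
  have hsplit : (fun n => x n * (a * (if n.val = 0 then 1 else 0) + b))
      = Pi.single ⟨0, hN⟩ (a * x ⟨0, hN⟩) + b • x := by
    funext n
    by_cases hn : n = ⟨0, hN⟩
    · subst hn
      simp
      ring
    · simp [hδ, hn, mul_comm]
  rw [hsplit, Matrix.mulVec_add, Matrix.mulVec_smul]
  simp
  ring

/-- If the partial DFT matrix `F_ℒ`, consisting of the rows of `F` indexed by the `L`
sampling points `ℒ = {ℓ(1), …, ℓ(L)}`, is injective on `k`-sparse vectors, then with the
four masks `p_s[n] = a_s·δ[n] + b_s`, every `k`-sparse `x` with `x[1] ≠ 0` is determined,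
up to a unimodular factor, by the intensities `|(F(x ⊙ p_s))[l]|²`, `s = 1,…,4`, `l ∈ ℒ`. -/
theorem sparse_phase_retrieval_fourier_masks
    (N k L : ℕ) (hk : 1 ≤ k) (hL : 1 ≤ L) (hN : 0 < N)
    (ℓ : Fin L → Fin N) (hℓ : Function.Injective ℓ)
    (hinj : ∀ x z : Fin N → ℂ, IsSparse k x → IsSparse k z →
      (∀ i : Fin L, (dftMatrix N).mulVec x (ℓ i) = (dftMatrix N).mulVec z (ℓ i)) → x = z)
    (p : Fin 4 → Fin N → ℂ)
    (hp : ∀ (s : Fin 4) (n : Fin N),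
      p s n = coefA s * (if n.val = 0 then 1 else 0) + coefB s)
    (x z : Fin N → ℂ) (hx : IsSparse k x) (hz : IsSparse k z)
    (hx1 : x ⟨0, hN⟩ ≠ 0)
    (h : ∀ (s : Fin 4) (i : Fin L),
      ‖(dftMatrix N).mulVec (fun n => x n * p s n) (ℓ i)‖ ^ 2
        = ‖(dftMatrix N).mulVec (fun n => z n * p s n) (ℓ i)‖ ^ 2) :
    ∃ c : ℂ, ‖c‖ = 1 ∧ z = c • x := by
  have hF := fun i => dftMatrix_apply_zero_ne_zero hN (ℓ i)
  have key := fun i : Fin L =>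
    norm_eq_and_mul_eq_of_intensities (mul_ne_zero (hF i) hx1) fun s => by
      simpa only [hp, mulVec_mul_delta_add_const hN] using h s i
  refine ⟨z ⟨0, hN⟩ / x ⟨0, hN⟩, ?_, ?_⟩
  · have h0 := (key ⟨0, hL⟩).1
    rw [norm_mul, norm_mul] at h0
    rw [norm_div, ← mul_left_cancel₀ (norm_ne_zero_iff.2 (hF _)) h0,
      div_self (norm_ne_zero_iff.2 hx1)]
  · refine hinj _ _ hz (hx.smul _) fun i => ?_
    have hi := (key i).2
    rw [mul_assoc, mul_assoc] at hi
    have hi := mul_left_cancel₀ (hF i) hi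
    rw [Matrix.mulVec_smul, Pi.smul_apply, smul_eq_mul, div_mul_eq_mul_div, eq_div_iff hx1,
      mul_comm, hi]
end
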